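/- (5-point property.) Let s ∈ K_r satisfy A_x(s) > 0 for all x, and set q* := Q(s) and r* := R(q*). Then for every q ∈ K_q and r ∈ K_r one has φ(q*, r*) + φ(q, r*) ≤ φ(q, r) + φ(q, s) in the extended reals. -/

import Mathlib

noncomputable section

open Finset

variable {X Y J : Type*}

/-- `f(u,v) = u·log u − u·log v` with the conventions `f(0,v) = 0` and `f(u,0) = +∞` for `u > 0`,
taking values in the extended reals. -/
def fdiv (u v : ℝ) : EReal :=
  if u = 0 then 0
  else if v = 0 then (⊤ : EReal)
  else ((u * Real.log u - u * Real.log v : ℝ) : EReal)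

/-- Marginal `p_x := ∑_y p_{x,y}`. -/
def margX [Fintype Y] (p : X → Y → ℝ) (x : X) : ℝ := ∑ y, p x y

/-- Marginal `p^y := ∑_x p_{x,y}`. -/
def margY [Fintype X] (p : X → Y → ℝ) (y : Y) : ℝ := ∑ x, p x y

/-- The polytope `K_q`: `q_{j|x} ≥ 0`, `∑_{j∋x} q_{j|x} = 1` for every `x`,
and `q_{j|x} = 0` whenever `x ∉ j`. -/
def Kq [Fintype J] [DecidableEq X] (S : J → Finset X) : Set (J → X → ℝ) :=
  {q | (∀ j x, 0 ≤ q j x) ∧ (∀ x, (∑ j, if x ∈ S j then q j x else 0) = 1) ∧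
    (∀ j x, x ∉ S j → q j x = 0)}

/-- The polytope `K_r`: `r_{j|y} ≥ 0` and `∑_j r_{j|y} = 1` for every `y`. -/
def Kr (J Y : Type*) [Fintype J] : Set (J → Y → ℝ) :=
  {r | (∀ j y, 0 ≤ r j y) ∧ ∀ y, (∑ j, r j y) = 1}

/-- `φ(q,r) := ∑_{x,y,j} p_{x,y} · f(q_{j|x}, r_{j|y})`, extended-real valued. -/
def phi [Fintype X] [Fintype Y] [Fintype J] (p : X → Y → ℝ)
    (q : J → X → ℝ) (r : J → Y → ℝ) : EReal :=
  ∑ x, ∑ y, ∑ j, (p x y : EReal) * fdiv (q j x) (r j y)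

/-- `δ(q,q') := ∑_x p_x ∑_{j∋x} f(q_{j|x}, q'_{j|x})`, extended-real valued. -/
def delta [Fintype X] [Fintype Y] [Fintype J] [DecidableEq X] (p : X → Y → ℝ)
    (S : J → Finset X) (q q' : J → X → ℝ) : EReal :=
  ∑ x, (margX p x : EReal) * ∑ j, (if x ∈ S j then fdiv (q j x) (q' j x) else 0)

/-- `R_{j|y}(q) := ∑_{x∈j} p_{x|y} q_{j|x}`. -/
def Rmap [Fintype X] [Fintype Y] [DecidableEq X] (p : X → Y → ℝ) (S : J → Finset X)
    (q : J → X → ℝ) : J → Y → ℝ :=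
  fun j y => ∑ x, if x ∈ S j then (p x y / margY p y) * q j x else 0

/-- `A_x(r) := ∑_{j∋x} ∏_y (r_{j|y})^{p^{y|x}}` (real powers, with `0^0 = 1`). -/
def Afun [Fintype Y] [Fintype J] [DecidableEq X] (p : X → Y → ℝ) (S : J → Finset X)
    (r : J → Y → ℝ) (x : X) : ℝ :=
  ∑ j, if x ∈ S j then (∏ y, r j y ^ (p x y / margX p x)) else 0

/-- `Q_{j|x}(r) := (∏_y (r_{j|y})^{p^{y|x}}) / A_x(r)` if `x ∈ j`, and `0` otherwise. -/
def Qmap [Fintype Y] [Fintype J] [DecidableEq X] (p : X → Y → ℝ) (S : J → Finset X)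
    (r : J → Y → ℝ) : J → X → ℝ :=
  fun j x => if x ∈ S j then (∏ y, r j y ^ (p x y / margX p x)) / Afun p S r x else 0

open Classical in
/-- `φ_r(r) := −∑_x p_x log A_x(r)`, equal to `+∞` if `A_x(r) = 0` for some `x`. -/
def phiR [Fintype X] [Fintype Y] [Fintype J] [DecidableEq X] (p : X → Y → ℝ)
    (S : J → Finset X) (r : J → Y → ℝ) : EReal :=
  if ∃ x, Afun p S r x = 0 then ⊤
  else (((- ∑ x, margX p x * Real.log (Afun p S r x)) : ℝ) : EReal)

/-- The explicit real-valued formula for `φ_q`: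
`∑_x p_x ∑_{j∋x} q_{j|x} log q_{j|x} − ∑_y p^y ∑_j R_{j|y}(q) log R_{j|y}(q)`
(with the convention `0·log 0 = 0`, automatic since `Real.log 0 = 0`). -/
def phiQexp [Fintype X] [Fintype Y] [Fintype J] [DecidableEq X] (p : X → Y → ℝ)
    (S : J → Finset X) (q : J → X → ℝ) : ℝ :=
  (∑ x, margX p x * ∑ j, if x ∈ S j then q j x * Real.log (q j x) else 0)
    - ∑ y, margY p y * ∑ j, Rmap p S q j y * Real.log (Rmap p S q j y)

/-- The convex corner `K_a := {a : 0 ≤ a_x ≤ A_x(r) (∀x) for some r ∈ K_r}`. -/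
def Ka [Fintype X] [Fintype Y] [Fintype J] [DecidableEq X] (p : X → Y → ℝ)
    (S : J → Finset X) : Set (X → ℝ) :=
  {a | ∃ r ∈ Kr J Y, ∀ x, 0 ≤ a x ∧ a x ≤ Afun p S r x}

open Classical in
/-- `φ_a(a) := −∑_x p_x log a_x`, equal to `+∞` if `a_x = 0` for some `x`. -/
def phiA [Fintype X] [Fintype Y] (p : X → Y → ℝ) (a : X → ℝ) : EReal :=
  if ∃ x, a x = 0 then ⊤
  else (((- ∑ x, margX p x * Real.log (a x)) : ℝ) : EReal)

theorem EReal.sum_ne_bot {ι : Type*} {t : Finset ι} {f : ι → EReal} (h : ∀ i ∈ t, f i ≠ ⊥) :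
    ∑ i ∈ t, f i ≠ ⊥ :=
  Finset.sum_induction f (· ≠ ⊥) (fun _ _ ha hb => EReal.add_ne_bot_iff.2 ⟨ha, hb⟩)
    EReal.zero_ne_bot h

theorem EReal.sum_eq_top {ι : Type*} {t : Finset ι} {f : ι → EReal} (h : ∀ i ∈ t, f i ≠ ⊥)
    {i : ι} (hi : i ∈ t) (hf : f i = ⊤) : ∑ i ∈ t, f i = ⊤ := by
  classical
  rw [← Finset.add_sum_erase t f hi, hf]
  exact EReal.top_add_of_ne_bot
    (EReal.sum_ne_bot fun k hk => h k (Finset.mem_of_mem_erase hk))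

theorem coe_mul_fdiv_ne_bot {a : ℝ} (ha : 0 ≤ a) (u v : ℝ) : (a : EReal) * fdiv u v ≠ ⊥ := by
  unfold fdiv
  split_ifs
  · simp
  · rcases ha.eq_or_lt with rfl | ha
    · simp
    · rw [EReal.coe_mul_top_of_pos ha]; simp
  · rw [← EReal.coe_mul]; exact EReal.coe_ne_bot _

theorem coe_mul_fdiv_of_ne_zero {a u v : ℝ} (h : a ≠ 0 → u ≠ 0 → v ≠ 0) :
    (a : EReal) * fdiv u v = ((a * (u * Real.log u - u * Real.log v) : ℝ) : EReal) := by
  unfold fdiv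
  by_cases hu : u = 0
  · simp [hu]
  by_cases ha : a = 0
  · simp [ha]
  rw [if_neg hu, if_neg (h ha hu), ← EReal.coe_mul]

theorem EReal.coe_finsetSum {ι : Type*} (t : Finset ι) (f : ι → ℝ) :
    ((∑ i ∈ t, f i : ℝ) : EReal) = ∑ i ∈ t, (f i : EReal) := by
  classical
  induction t using Finset.induction_on with
  | empty => simp
  | insert a t ha ih => rw [sum_insert ha, sum_insert ha, EReal.coe_add, ih]

theorem sum_eq_one_of_mem_Kq [Fintype J] [DecidableEq X] {S : J → Finset X} {q : J → X → ℝ}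
    (hq : q ∈ Kq S) (x : X) : ∑ j, q j x = 1 := by
  rw [← hq.2.1 x]
  refine sum_congr rfl fun j _ => ?_
  split_ifs with h
  · rfl
  · exact hq.2.2 j x h

theorem prod_rpow_nonneg [Fintype Y] [Fintype J] {p : X → Y → ℝ} {s : J → Y → ℝ}
    (hs : s ∈ Kr J Y) (j : J) (x : X) : 0 ≤ ∏ y, s j y ^ (p x y / margX p x) :=
  prod_nonneg fun y _ => Real.rpow_nonneg (hs.1 j y) _

section

variable [Fintype Y] [Fintype J] [DecidableEq X] {p : X → Y → ℝ} {S : J → Finset X}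

theorem Qmap_mem_Kq {s : J → Y → ℝ} (hs : s ∈ Kr J Y) (hA : ∀ x, 0 < Afun p S s x) :
    Qmap p S s ∈ Kq S := by
  refine ⟨fun j x => ?_, fun x => ?_, fun j x h => by simp [Qmap, h]⟩
  · unfold Qmap
    split_ifs
    · exact div_nonneg (prod_rpow_nonneg hs j x) (hA x).le
    · exact le_rfl
  · rw [← div_self (hA x).ne']
    conv_rhs => enter [1]; rw [Afun]
    rw [sum_div]
    refine sum_congr rfl fun j _ => ?_
    by_cases h : x ∈ S j <;> simp [Qmap, h]

theorem Qmap_ne_zero_iff (hpx : ∀ x, 0 < margX p x) {s : J → Y → ℝ}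
    (hs : s ∈ Kr J Y) (hA : ∀ x, 0 < Afun p S s x) (j : J) (x : X) :
    Qmap p S s j x ≠ 0 ↔ x ∈ S j ∧ ∀ y, p x y ≠ 0 → s j y ≠ 0 := by
  by_cases h : x ∈ S j
  · simp [Qmap, h, (hA x).ne', prod_eq_zero_iff, Real.rpow_eq_zero_iff_of_nonneg (hs.1 j _),
      (hpx x).ne']
    exact forall_congr' fun y => by tauto
  · simp [Qmap, h]

/-- The weighted log-likelihood of `s` splits through `Q(s)` and the normalizer `A(s)`. -/
theorem sum_mul_log_eq (hpx : ∀ x, 0 < margX p x) {s : J → Y → ℝ}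
    (hs : s ∈ Kr J Y) (hA : ∀ x, 0 < Afun p S s x) {j : J} {x : X} (h : Qmap p S s j x ≠ 0) :
    ∑ y, p x y * Real.log (s j y) =
      margX p x * (Real.log (Qmap p S s j x) + Real.log (Afun p S s x)) := by
  obtain ⟨hj, hsupp⟩ := (Qmap_ne_zero_iff hpx hs hA j x).1 h
  have hne : ∀ y, s j y ^ (p x y / margX p x) ≠ 0 := fun y => by
    rw [Ne, Real.rpow_eq_zero_iff_of_nonneg (hs.1 j y)]
    rintro ⟨h0, h1⟩
    exact hsupp y (fun h => h1 (by simp [h])) h0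
  have hprod : ∏ y, s j y ^ (p x y / margX p x) = Qmap p S s j x * Afun p S s x := by
    simp [Qmap, hj, (hA x).ne']
  rw [← Real.log_mul h (hA x).ne', ← hprod, Real.log_prod fun y _ => hne y, mul_sum]
  refine sum_congr rfl fun y _ => ?_
  by_cases hp0 : p x y = 0
  · simp [hp0]
  · rw [Real.log_rpow ((hs.1 j y).lt_of_ne' (hsupp y hp0)), ← mul_assoc,
      mul_div_cancel₀ _ (hpx x).ne']

end

section

variable [Fintype X] [Fintype Y] [Fintype J] {p : X → Y → ℝ}

theorem phi_ne_bot (hp : ∀ x y, 0 ≤ p x y) (q : J → X → ℝ) (r : J → Y → ℝ) :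
    phi p q r ≠ ⊥ :=
  EReal.sum_ne_bot fun x _ => EReal.sum_ne_bot fun y _ => EReal.sum_ne_bot fun _ _ =>
    coe_mul_fdiv_ne_bot (hp x y) _ _

theorem ne_zero_of_phi_ne_top (hp : ∀ x y, 0 ≤ p x y) {q : J → X → ℝ} {r : J → Y → ℝ}
    (h : phi p q r ≠ ⊤) {x : X} {y : Y} {j : J} (hpxy : p x y ≠ 0) (hq : q j x ≠ 0) :
    r j y ≠ 0 := by
  intro hr
  refine h (EReal.sum_eq_top (fun x _ => EReal.sum_ne_bot fun y _ => EReal.sum_ne_bot fun _ _ =>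
    coe_mul_fdiv_ne_bot (hp x y) _ _) (mem_univ x) (EReal.sum_eq_top (fun y _ =>
    EReal.sum_ne_bot fun _ _ => coe_mul_fdiv_ne_bot (hp x y) _ _) (mem_univ y)
    (EReal.sum_eq_top (fun _ _ => coe_mul_fdiv_ne_bot (hp x y) _ _) (mem_univ j) ?_)))
  rw [fdiv, if_neg hq, if_pos hr]
  exact EReal.coe_mul_top_of_pos ((hp x y).lt_of_ne' hpxy)

theorem phi_eq_coe {q : J → X → ℝ} {r : J → Y → ℝ}
    (h : ∀ x y j, p x y ≠ 0 → q j x ≠ 0 → r j y ≠ 0) :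
    phi p q r = ((∑ x, ∑ y, ∑ j,
      p x y * (q j x * Real.log (q j x) - q j x * Real.log (r j y)) : ℝ) : EReal) := by
  simp only [phi, EReal.coe_finsetSum]
  exact sum_congr rfl fun x _ => sum_congr rfl fun y _ => sum_congr rfl fun j _ =>
    coe_mul_fdiv_of_ne_zero (h x y j)

variable [DecidableEq X] {S : J → Finset X}

theorem sum_mul_mul_log_eq (hpx : ∀ x, 0 < margX p x) {s : J → Y → ℝ}
    (hs : s ∈ Kr J Y) (hA : ∀ x, 0 < Afun p S s x) {u : J → X → ℝ} (hu : u ∈ Kq S)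
    (h : ∀ j x, u j x ≠ 0 → Qmap p S s j x ≠ 0) :
    ∑ x, ∑ y, ∑ j, p x y * (u j x * Real.log (s j y)) =
      (∑ x, ∑ y, ∑ j, p x y * (u j x * Real.log (Qmap p S s j x))) +
        ∑ x, margX p x * Real.log (Afun p S s x) := by
  rw [← sum_add_distrib]
  refine sum_congr rfl fun x _ => ?_
  have hL : margX p x * Real.log (Afun p S s x) =
      ∑ j, u j x * (margX p x * Real.log (Afun p S s x)) := by
    rw [← sum_mul, sum_eq_one_of_mem_Kq hu, one_mul]
  rw [hL, sum_comm, sum_comm (s := (univ : Finset Y)), ← sum_add_distrib]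
  refine sum_congr rfl fun j _ => ?_
  by_cases hj : u j x = 0
  · simp [hj]
  · have h1 := sum_mul_log_eq hpx hs hA (h j x hj)
    simp only [mul_left_comm (p x _), ← mul_sum, h1, ← sum_mul]
    rw [margX]
    ring

theorem margY_mul_Rmap (hpy : ∀ y, 0 < margY p y) {q : J → X → ℝ} (hq : q ∈ Kq S)
    (j : J) (y : Y) : margY p y * Rmap p S q j y = ∑ x, p x y * q j x := by
  rw [Rmap, mul_sum]
  refine sum_congr rfl fun x _ => ?_
  split_ifs with h
  · rw [← mul_assoc, mul_div_cancel₀ _ (hpy y).ne']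
  · simp [hq.2.2 j x h]

theorem Rmap_nonneg (hp : ∀ x y, 0 ≤ p x y) (hpy : ∀ y, 0 < margY p y) {q : J → X → ℝ}
    (hq : q ∈ Kq S) (j : J) (y : Y) : 0 ≤ Rmap p S q j y :=
  nonneg_of_mul_nonneg_right ((margY_mul_Rmap hpy hq j y).symm ▸
    sum_nonneg fun x _ => mul_nonneg (hp x y) (hq.1 j x)) (hpy y)

theorem Rmap_ne_zero (hp : ∀ x y, 0 ≤ p x y) (hpy : ∀ y, 0 < margY p y) {q : J → X → ℝ}
    (hq : q ∈ Kq S) {j : J} {x : X} {y : Y} (hpxy : p x y ≠ 0) (hqx : q j x ≠ 0) :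
    Rmap p S q j y ≠ 0 := by
  intro h
  have h1 := margY_mul_Rmap hpy hq j y
  rw [h, mul_zero, eq_comm, sum_eq_zero_iff_of_nonneg
    fun x _ => mul_nonneg (hp x y) (hq.1 j x)] at h1
  exact mul_ne_zero hpxy hqx (h1 x (mem_univ x))

theorem sum_mul_div_Rmap_le_one (hptot : ∑ x, ∑ y, p x y = 1)
    (hpy : ∀ y, 0 < margY p y) {q : J → X → ℝ} (hq : q ∈ Kq S) {r : J → Y → ℝ}
    (hr : r ∈ Kr J Y) :
    ∑ x, ∑ y, ∑ j, p x y * q j x * (r j y / Rmap p S q j y) ≤ 1 := by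
  have htot : ∑ y, margY p y = 1 := by
    rw [← hptot, sum_comm]
    rfl
  rw [sum_comm, ← htot]
  refine sum_le_sum fun y _ => ?_
  rw [sum_comm, ← mul_one (margY p y), ← hr.2 y, mul_sum]
  refine sum_le_sum fun j _ => ?_
  rw [← sum_mul, ← margY_mul_Rmap hpy hq, mul_assoc]
  refine mul_le_mul_of_nonneg_left ?_ (hpy y).le
  by_cases h : Rmap p S q j y = 0
  · simpa [h] using hr.1 j y
  · rw [mul_div_cancel₀ _ h]

theorem sum_mul_eq_one (hptot : ∑ x, ∑ y, p x y = 1) {q : J → X → ℝ} (hq : q ∈ Kq S) :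
    ∑ x, ∑ y, ∑ j, p x y * q j x = 1 := by
  simp only [← mul_sum, sum_eq_one_of_mem_Kq hq, mul_one, hptot]

/-- A Gibbs-type inequality: the gain of `q'` and `r` over `q` and `R(q')` is nonpositive. -/
theorem sum_mul_log_le_zero (hp : ∀ x y, 0 ≤ p x y) (hptot : ∑ x, ∑ y, p x y = 1)
    (hpy : ∀ y, 0 < margY p y) {q q' : J → X → ℝ} (hq : q ∈ Kq S) (hq' : q' ∈ Kq S)
    (hqq' : ∀ j x, q j x ≠ 0 → q' j x ≠ 0) {r : J → Y → ℝ} (hr : r ∈ Kr J Y)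
    (h : ∀ x y j, p x y ≠ 0 → q j x ≠ 0 → r j y ≠ 0) :
    ∑ x, ∑ y, ∑ j, p x y * (q j x * (Real.log (q' j x) + Real.log (r j y)
      - Real.log (Rmap p S q' j y) - Real.log (q j x))) ≤ 0 := by
  have key : ∀ x y j, p x y * (q j x * (Real.log (q' j x) + Real.log (r j y)
      - Real.log (Rmap p S q' j y) - Real.log (q j x))) ≤
      p x y * q' j x * (r j y / Rmap p S q' j y) - p x y * q j x := by
    intro x y j
    have hR := Rmap_nonneg hp hpy hq' j y
    by_cases hpz : p x y = 0
    · simp [hpz]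
    by_cases hqz : q j x = 0
    · simpa [hqz] using mul_nonneg (mul_nonneg (hp x y) (hq'.1 j x)) (div_nonneg (hr.1 j y) hR)
    have hqp := (hq.1 j x).lt_of_ne' hqz
    have hqp' := (hq'.1 j x).lt_of_ne' (hqq' j x hqz)
    have hrp := (hr.1 j y).lt_of_ne' (h x y j hpz hqz)
    have hRp := hR.lt_of_ne' (Rmap_ne_zero hp hpy hq' hpz hqp'.ne')
    have hlog := Real.log_le_sub_one_of_pos
      (div_pos (div_pos (mul_pos hqp' hrp) hRp) hqp)
    rw [Real.log_div (div_pos (mul_pos hqp' hrp) hRp).ne' hqz,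
      Real.log_div (mul_pos hqp' hrp).ne' hRp.ne', Real.log_mul hqp'.ne' hrp.ne'] at hlog
    have := mul_le_mul_of_nonneg_left (mul_le_mul_of_nonneg_left hlog hqp.le) (hp x y)
    refine this.trans_eq ?_
    field_simp
  have hsum := sum_le_sum fun x (_ : x ∈ univ) => sum_le_sum fun y (_ : y ∈ univ) =>
    sum_le_sum fun j (_ : j ∈ univ) => key x y j
  simp only [sum_sub_distrib (s := (univ : Finset J)), sum_sub_distrib (s := (univ : Finset Y)),
    sum_sub_distrib (s := (univ : Finset X))] at hsum
  have h1 := sum_mul_div_Rmap_le_one hptot hpy hq' hr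
  have h2 := sum_mul_eq_one hptot hq
  refine le_trans ?_ (hsum.trans (by linarith))
  exact le_rfl

end

/-- 5-point property: if `s ∈ K_r` has `A_x(s) > 0` for all `x`, and
`q* := Q(s)`, `r* := R(q*)`, then for every `q ∈ K_q` and `r ∈ K_r`,
`φ(q*, r*) + φ(q, r*) ≤ φ(q, r) + φ(q, s)` in the extended reals. -/
theorem five_point_property (X Y J : Type*) [Fintype X] [Fintype Y] [Fintype J]
    [Nonempty X] [Nonempty Y] [DecidableEq X]
    (p : X → Y → ℝ) (S : J → Finset X)
    (hp : ∀ x y, 0 ≤ p x y) (hptot : ∑ x, ∑ y, p x y = 1)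
    (hpx : ∀ x, 0 < margX p x) (hpy : ∀ y, 0 < margY p y)
    (hcov : ∀ x, ∃ j, x ∈ S j) :
    ∀ s ∈ Kr J Y, (∀ x, 0 < Afun p S s x) →
      ∀ q ∈ Kq S, ∀ r ∈ Kr J Y,
        phi p (Qmap p S s) (Rmap p S (Qmap p S s)) + phi p q (Rmap p S (Qmap p S s))
          ≤ phi p q r + phi p q s := by
  intro s hs hA q hq r hr
  set q' := Qmap p S s with hq'_def
  have hq' : q' ∈ Kq S := Qmap_mem_Kq hs hA
  by_cases hqr : phi p q r = ⊤
  · rw [hqr, EReal.top_add_of_ne_bot (phi_ne_bot hp q s)]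
    exact le_top
  by_cases hqs : phi p q s = ⊤
  · rw [hqs, EReal.add_top_of_ne_bot (phi_ne_bot hp q r)]
    exact le_top
  have hr_supp : ∀ x y j, p x y ≠ 0 → q j x ≠ 0 → r j y ≠ 0 := fun x y j =>
    ne_zero_of_phi_ne_top hp hqr
  have hs_supp : ∀ x y j, p x y ≠ 0 → q j x ≠ 0 → s j y ≠ 0 := fun x y j =>
    ne_zero_of_phi_ne_top hp hqs
  have hqq' : ∀ j x, q j x ≠ 0 → q' j x ≠ 0 := fun j x h =>
    (Qmap_ne_zero_iff hpx hs hA j x).2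
      ⟨by_contra fun hj => h (hq.2.2 j x hj), fun y hy => hs_supp x y j hy h⟩
  have hs_supp' : ∀ x y j, p x y ≠ 0 → q' j x ≠ 0 → s j y ≠ 0 := fun x y j hy h =>
    ((Qmap_ne_zero_iff hpx hs hA j x).1 h).2 y hy
  have hR : ∀ x y j, p x y ≠ 0 → q' j x ≠ 0 → Rmap p S q' j y ≠ 0 := fun x y j =>
    Rmap_ne_zero hp hpy hq'
  rw [phi_eq_coe hR, phi_eq_coe fun x y j hy h => hR x y j hy (hqq' j x h),
    phi_eq_coe hr_supp, phi_eq_coe hs_supp, ← EReal.coe_add, ← EReal.coe_add,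
    EReal.coe_le_coe_iff]
  have h1 := sum_mul_log_le_zero hp hptot hpy hq hq' hqq' hr hr_supp
  have h2 := sum_mul_log_le_zero hp hptot hpy hq' hq' (fun _ _ => id) hs hs_supp'
  have h3 := sum_mul_mul_log_eq hpx hs hA hq hqq'
  have h4 := sum_mul_mul_log_eq hpx hs hA hq' fun _ _ => id
  rw [← hq'_def] at h3 h4
  simp only [mul_sub, mul_add, sum_sub_distrib, sum_add_distrib] at h1 h2 ⊢
  linarith
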